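/- Let r ≥ 3 be fixed. There exist constants C > 0 and δ > 0 depending only on r such that for every degree sequence k with sum M divisible by r and k_max^3 ≤ δM, the expected number of parts of a uniformly random Q ∈ Λ_r(k) that contain three or more points from a single cell is at most C·M_3/M^2, which is at most C·k_max^2/M. -/

import Mathlib

open scoped Classical BigOperators

/-- The set of points for the configuration model: cell `i` contains `k i` points. -/
abbrev Pts {n : ℕ} (k : Fin n → ℕ) : Type := (i : Fin n) × Fin (k i)

/-- `M`, the total degree. -/
def Mtot {n : ℕ} (k : Fin n → ℕ) : ℕ := ∑ i, k i

/-- `M₂ = Σ kᵢ(kᵢ−1)`. -/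
def M2 {n : ℕ} (k : Fin n → ℕ) : ℕ := ∑ i, k i * (k i - 1)

/-- `M₃ = Σ kᵢ(kᵢ−1)(kᵢ−2)`. -/
def M3 {n : ℕ} (k : Fin n → ℕ) : ℕ := ∑ i, k i * (k i - 1) * (k i - 2)

/-- The maximum degree. -/
def kmax {n : ℕ} (k : Fin n → ℕ) : ℕ := Finset.univ.sup k

/-- `Q` is an unordered partition of the point set into parts of size `r`. -/
def IsPartition {n : ℕ} (r : ℕ) (k : Fin n → ℕ) (Q : Finset (Finset (Pts k))) : Prop :=
  (∀ U ∈ Q, U.card = r) ∧ ∀ p : Pts k, ∃! U, U ∈ Q ∧ p ∈ U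

/-- `Λ_r(k)`, the set of partitions of the points into parts of size `r`. -/
def Lam {n : ℕ} (r : ℕ) (k : Fin n → ℕ) : Set (Finset (Finset (Pts k))) :=
  {Q | IsPartition r k Q}

/-- `Λ_r(k)` as a finset. -/
noncomputable def LamFinset {n : ℕ} (r : ℕ) (k : Fin n → ℕ) :
    Finset (Finset (Finset (Pts k))) :=
  Finset.univ.filter fun Q => IsPartition r k Q

/-- The set of vertices of the edge of `G(Q)` corresponding to a part `U`. -/
def vset {n : ℕ} {k : Fin n → ℕ} (U : Finset (Pts k)) : Finset (Fin n) :=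
  U.image Sigma.fst

/-- Multiplicity of vertex `i` in the edge corresponding to a part `U`. -/
def mult {n : ℕ} {k : Fin n → ℕ} (U : Finset (Pts k)) (i : Fin n) : ℕ :=
  (U.filter fun p => p.1 = i).card

/-- `U` contains a loop: two distinct points lying in the same cell. -/
def HasLoop {n : ℕ} {k : Fin n → ℕ} (U : Finset (Pts k)) : Prop :=
  ∃ x ∈ U, ∃ y ∈ U, x ≠ y ∧ x.1 = y.1

/-- The number of parts of `Q` which contain a loop. -/
noncomputable def nloops {n : ℕ} {k : Fin n → ℕ} (Q : Finset (Finset (Pts k))) : ℕ :=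
  (Q.filter fun U => HasLoop U).card

/-- `N = max(⌈log M⌉, ⌈9(r−1)M₂/M⌉)`. -/
noncomputable def Nbound {n : ℕ} (r : ℕ) (k : Fin n → ℕ) : ℕ :=
  max ⌈Real.log (Mtot k)⌉₊ ⌈(9 * ((r : ℝ) - 1) * (M2 k : ℝ)) / (Mtot k : ℝ)⌉₊

/-- `Λ_r⁺(k)`: partitions satisfying properties (i)–(iv). -/
noncomputable def LamPlus {n : ℕ} (r : ℕ) (k : Fin n → ℕ) :
    Set (Finset (Finset (Pts k))) :=
  {Q | IsPartition r k Q ∧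
    (∀ U ∈ Q, ∀ i, mult U i ≤ 2) ∧
    (∀ U ∈ Q, ∀ i j, mult U i = 2 → mult U j = 2 → i = j) ∧
    (∀ U ∈ Q, ∀ W ∈ Q, U ≠ W → (vset U ∩ vset W).card ≤ 2) ∧
    nloops Q ≤ Nbound r k}

/-- `C_ℓ`: partitions in `Λ_r⁺(k)` with exactly `ℓ` parts containing a loop. -/
noncomputable def Cset {n : ℕ} (r : ℕ) (k : Fin n → ℕ) (ℓ : ℕ) :
    Set (Finset (Finset (Pts k))) :=
  {Q ∈ LamPlus r k | nloops Q = ℓ}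

/-- The result of an ℓ-switching replacing parts `U`, `W₁`, `W₂`. -/
def switchResult {n : ℕ} {k : Fin n → ℕ} (Q : Finset (Finset (Pts k)))
    (U W₁ W₂ : Finset (Pts k)) (x₁ x₂ y₁ y₂ : Pts k) : Finset (Finset (Pts k)) :=
  (Q \ {U, W₁, W₂}) ∪
    {(U \ {x₁, x₂}) ∪ {y₁, y₂}, (W₁ \ {y₁}) ∪ {x₁}, (W₂ \ {y₂}) ∪ {x₂}}

/-- `(x₁,x₂,y₁,y₂)` specifies an ℓ-switching in `Q` with parts `U`, `W₁`, `W₂`. -/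
def IsSwitching {n : ℕ} {k : Fin n → ℕ} (Q : Finset (Finset (Pts k)))
    (U W₁ W₂ : Finset (Pts k)) (x₁ x₂ y₁ y₂ : Pts k) : Prop :=
  U ∈ Q ∧ W₁ ∈ Q ∧ W₂ ∈ Q ∧ U ≠ W₁ ∧ U ≠ W₂ ∧ W₁ ≠ W₂ ∧
  x₁ ∈ U ∧ x₂ ∈ U ∧ x₁ ≠ x₂ ∧ x₁.1 = x₂.1 ∧
  y₁ ∈ W₁ ∧ y₂ ∈ W₂ ∧ y₁.1 ≠ y₂.1

/-- The result of a reverse ℓ-switching replacing parts `Û`, `Ŵ₁`, `Ŵ₂`. -/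
def revSwitchResult {n : ℕ} {k : Fin n → ℕ} (Q' : Finset (Finset (Pts k)))
    (Uh W₁h W₂h : Finset (Pts k)) (x₁ x₂ y₁ y₂ : Pts k) : Finset (Finset (Pts k)) :=
  (Q' \ {Uh, W₁h, W₂h}) ∪
    {(Uh \ {y₁, y₂}) ∪ {x₁, x₂}, (W₁h \ {x₁}) ∪ {y₁}, (W₂h \ {x₂}) ∪ {y₂}}

/-- `(x₁,x₂,y₁,y₂)` specifies a reverse ℓ-switching in `Q'` with parts `Û`, `Ŵ₁`, `Ŵ₂`. -/
def IsRevSwitching {n : ℕ} {k : Fin n → ℕ} (Q' : Finset (Finset (Pts k)))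
    (Uh W₁h W₂h : Finset (Pts k)) (x₁ x₂ y₁ y₂ : Pts k) : Prop :=
  Uh ∈ Q' ∧ W₁h ∈ Q' ∧ W₂h ∈ Q' ∧ Uh ≠ W₁h ∧ Uh ≠ W₂h ∧ W₁h ≠ W₂h ∧
  x₁ ∈ W₁h ∧ x₂ ∈ W₂h ∧ x₁.1 = x₂.1 ∧
  y₁ ∈ Uh ∧ y₂ ∈ Uh ∧ y₁ ≠ y₂ ∧ y₁.1 ≠ y₂.1

/-- `Q` is simple: every edge of `G(Q)` consists of distinct vertices and all
edges are distinct. -/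
def SimpleQ {n : ℕ} {k : Fin n → ℕ} (Q : Finset (Finset (Pts k))) : Prop :=
  (∀ U ∈ Q, (vset U).card = U.card) ∧
  ∀ U ∈ Q, ∀ W ∈ Q, U ≠ W → vset U ≠ vset W

/-- `|H_r(k)|`: the number of simple `r`-uniform hypergraphs on `{1,…,n}` with
degree sequence `k`, a hypergraph being recorded as its (distinct) edge set. -/
noncomputable def Hcount (r : ℕ) {n : ℕ} (k : Fin n → ℕ) : ℕ :=
  Set.ncard {E : Finset (Finset (Fin n)) |
    (∀ e ∈ E, e.card = r) ∧ ∀ i, (E.filter fun e => i ∈ e).card = k i}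

/-- The triple `t` lies inside one part of `Q`. -/
def InPart {n : ℕ} {k : Fin n → ℕ} (t : Fin 3 ↪ Pts k) (Q : Finset (Finset (Pts k))) : Prop :=
  ∃ U ∈ Q, ∀ j, t j ∈ U

lemma isPartition_perm {n : ℕ} {r : ℕ} {k : Fin n → ℕ} (σ : Equiv.Perm (Pts k))
    {Q : Finset (Finset (Pts k))} (h : IsPartition r k Q) :
    IsPartition r k (σ.finsetCongr.finsetCongr Q) := by
  obtain ⟨h1, h2⟩ := h
  constructor
  · intro U hU
    simp only [Equiv.finsetCongr_apply, Finset.mem_map] at hU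
    obtain ⟨V, hV, rfl⟩ := hU
    simpa using h1 V hV
  · intro p
    obtain ⟨U, ⟨hU, hp⟩, huniq⟩ := h2 (σ.symm p)
    refine ⟨σ.finsetCongr U, ⟨?_, ?_⟩, ?_⟩
    · simp only [Equiv.finsetCongr_apply, Finset.mem_map]
      exact ⟨U, hU, rfl⟩
    · simp only [Equiv.finsetCongr_apply, Finset.mem_map]
      exact ⟨_, hp, by simp⟩
    · rintro W ⟨hW, hpW⟩
      rw [Equiv.finsetCongr_apply, Finset.mem_map] at hW
      obtain ⟨V, hV, rfl⟩ := hW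
      have : σ.symm p ∈ V := by
        have h3 : p ∈ V.map σ.toEmbedding := hpW
        rw [Finset.mem_map] at h3
        obtain ⟨q, hq, rfl⟩ := h3
        simpa using hq
      rw [huniq V ⟨hV, this⟩]
      rfl

lemma inPart_card_le {n : ℕ} {r : ℕ} {k : Fin n → ℕ} (s t : Fin 3 ↪ Pts k) :
    ((LamFinset r k).filter fun Q => InPart s Q).card ≤
      ((LamFinset r k).filter fun Q => InPart t Q).card := by
  obtain ⟨σ, hσ⟩ : ∃ σ : Equiv.Perm (Pts k), ∀ j, σ (s j) = t j := by
    have := Equiv.Perm.isMultiplyPretransitive (Pts k) 3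
    obtain ⟨σ, hσ⟩ := MulAction.exists_smul_eq (Equiv.Perm (Pts k)) s t
    exact ⟨σ, fun j => by rw [← hσ]; rfl⟩
  apply Finset.card_le_card_of_injOn (fun Q => σ.finsetCongr.finsetCongr Q)
  · intro Q hQ
    simp only [LamFinset, Finset.coe_filter, Finset.mem_filter, Finset.mem_univ, true_and,
      Set.mem_ofPred_eq] at hQ ⊢
    refine ⟨isPartition_perm σ hQ.1, ?_⟩
    obtain ⟨U, hU, hs⟩ := hQ.2
    refine ⟨σ.finsetCongr U, ?_, fun j => ?_⟩
    · simp only [Equiv.finsetCongr_apply, Finset.mem_map]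
      exact ⟨U, hU, rfl⟩
    · simp only [Equiv.finsetCongr_apply, Finset.mem_map]
      exact ⟨_, hs j, hσ j⟩
  · exact (Equiv.injective _).injOn

lemma card_pts {n : ℕ} (k : Fin n → ℕ) : Fintype.card (Pts k) = Mtot k := by
  simp [Mtot]

lemma part_card {n : ℕ} {r : ℕ} {k : Fin n → ℕ} {Q : Finset (Finset (Pts k))}
    (h : IsPartition r k Q) : Q.card * r = Mtot k := by
  have hb : Q.biUnion id = Finset.univ := by
    ext p
    obtain ⟨U, hU, -⟩ := h.2 p
    simp only [Finset.mem_biUnion, id, Finset.mem_univ, iff_true]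
    exact ⟨U, hU⟩
  have hc : (Q.biUnion id).card = ∑ U ∈ Q, U.card := by
    apply Finset.card_biUnion
    intro U hU V hV hne
    refine Finset.disjoint_left.2 ?_
    intro p hp hp'
    exact hne ((h.2 p).unique ⟨hU, hp⟩ ⟨hV, hp'⟩)
  rw [hb, Finset.card_univ, card_pts, Finset.sum_congr rfl h.1] at hc
  simp [hc]

lemma triples_card_le {n : ℕ} {r : ℕ} {k : Fin n → ℕ} {Q : Finset (Finset (Pts k))}
    (h : IsPartition r k Q) :
    (Finset.univ.filter fun t : Fin 3 ↪ Pts k => InPart t Q).card ≤ Mtot k * r ^ 2 := by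
  have hsub : (Finset.univ.filter fun t : Fin 3 ↪ Pts k => InPart t Q) ⊆
      Q.biUnion fun U => Finset.univ.filter fun t : Fin 3 ↪ Pts k => ∀ j, t j ∈ U := by
    intro t ht
    obtain ⟨U, hU, hj⟩ := (Finset.mem_filter.1 ht).2
    exact Finset.mem_biUnion.2 ⟨U, hU, Finset.mem_filter.2 ⟨Finset.mem_univ _, hj⟩⟩
  have hU : ∀ U ∈ Q, (Finset.univ.filter fun t : Fin 3 ↪ Pts k => ∀ j, t j ∈ U).card ≤ r ^ 3 := by
    intro U hU
    have : (Finset.univ.filter fun t : Fin 3 ↪ Pts k => ∀ j, t j ∈ U).card ≤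
        (Fintype.piFinset fun _ : Fin 3 => U).card := by
      apply Finset.card_le_card_of_injOn (fun (t : Fin 3 ↪ Pts k) => (t : Fin 3 → Pts k))
      · intro t ht
        exact Finset.mem_coe.2 (Fintype.mem_piFinset.2 (Finset.mem_filter.1 ht).2)
      · exact DFunLike.coe_injective.injOn
    simpa [h.1 U hU] using this
  calc _ ≤ _ := Finset.card_le_card hsub
    _ ≤ ∑ U ∈ Q, _ := Finset.card_biUnion_le
    _ ≤ ∑ U ∈ Q, r ^ 3 := Finset.sum_le_sum hU
    _ = (Q.card * r) * r ^ 2 := by rw [Finset.sum_const, smul_eq_mul]; ring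
    _ = _ := by rw [part_card h]

/-- All three points of the triple lie in the same cell. -/
def SameCell {n : ℕ} {k : Fin n → ℕ} (t : Fin 3 ↪ Pts k) : Prop :=
  ∃ i, ∀ j, (t j).1 = i

lemma bad_card_le {n : ℕ} {r : ℕ} {k : Fin n → ℕ} {Q : Finset (Finset (Pts k))}
    (h : IsPartition r k Q) :
    (Q.filter fun U => ∃ i, 3 ≤ mult U i).card ≤
      ((Finset.univ.filter fun t : Fin 3 ↪ Pts k => SameCell t).filter
        fun t => InPart t Q).card := by
  have hex : ∀ U ∈ Q.filter fun U => ∃ i, 3 ≤ mult U i,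
      ∃ t : Fin 3 ↪ Pts k, SameCell t ∧ ∀ j, t j ∈ U := by
    intro U hU
    obtain ⟨i, hi⟩ := (Finset.mem_filter.1 hU).2
    have hc : Fintype.card (Fin 3) ≤ Fintype.card (U.filter fun p => p.1 = i) := by
      rw [Fintype.card_coe, Fintype.card_fin]
      exact hi
    obtain ⟨e⟩ := Function.Embedding.nonempty_of_card_le hc
    refine ⟨e.trans (Function.Embedding.subtype _), ⟨i, fun j => ?_⟩, fun j => ?_⟩
    · exact (Finset.mem_filter.1 (e j).2).2
    · exact (Finset.mem_filter.1 (e j).2).1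
  rcases (Q.filter fun U => ∃ i, 3 ≤ mult U i).eq_empty_or_nonempty with he | ⟨U0, hU0⟩
  · rw [he]
    simp
  have : Nonempty (Fin 3 ↪ Pts k) := ⟨(hex U0 hU0).choose⟩
  choose! f hf using hex
  apply Finset.card_le_card_of_injOn f
  · intro U hU
    have := hf U hU
    simp only [Finset.coe_filter, Finset.mem_filter, Finset.mem_univ, true_and, Set.mem_ofPred_eq]
    exact ⟨this.1, U, (Finset.mem_filter.1 hU).1, this.2⟩
  · intro U hU V hV hUV
    have h1 := (hf U hU).2 0
    have h2 := (hf V hV).2 0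
    rw [← hUV] at h2
    exact (h.2 _).unique ⟨(Finset.mem_filter.1 hU).1, h1⟩ ⟨(Finset.mem_filter.1 hV).1, h2⟩

lemma sameCell_card_le {n : ℕ} (k : Fin n → ℕ) :
    (Finset.univ.filter fun t : Fin 3 ↪ Pts k => SameCell t).card ≤ M3 k := by
  have hM : M3 k = Fintype.card ((i : Fin n) × (Fin 3 ↪ Fin (k i))) := by
    rw [Fintype.card_sigma]
    apply Finset.sum_congr rfl
    intro i _
    rw [Fintype.card_embedding_eq]
    simp [Nat.descFactorial_succ]
    ring
  rw [hM, ← Finset.card_univ]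
  apply Finset.card_le_card_of_surjOn
    (fun q : (i : Fin n) × (Fin 3 ↪ Fin (k i)) =>
      q.2.trans (Function.Embedding.sigmaMk (β := fun i => Fin (k i)) q.1))
  intro t ht
  obtain ⟨i, hi⟩ := (Finset.mem_filter.1 ht).2
  have : ∀ j, ∃ a : Fin (k i), (⟨i, a⟩ : Pts k) = t j := by
    intro j
    have := hi j
    rcases hp : t j with ⟨a, b⟩
    rw [hp] at this
    subst this
    exact ⟨b, rfl⟩
  choose g hg using this
  refine ⟨⟨i, ⟨g, fun a b hab => ?_⟩⟩, by simp, ?_⟩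
  · apply t.injective
    rw [← hg a, ← hg b, hab]
  · ext1 j
    exact hg j

lemma main_count {n : ℕ} (r : ℕ) (k : Fin n → ℕ) :
    (∑ Q ∈ LamFinset r k, (Q.filter fun U => ∃ i, 3 ≤ mult U i).card) *
      (Mtot k).descFactorial 3 ≤ M3 k * ((LamFinset r k).card * (Mtot k * r ^ 2)) := by
  have hL : ∀ Q ∈ LamFinset r k, IsPartition r k Q := fun Q hQ => (Finset.mem_filter.1 hQ).2
  set S := Finset.univ.filter fun t : Fin 3 ↪ Pts k => SameCell t with hS
  have hswap : ∀ A : Finset (Fin 3 ↪ Pts k),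
      ∑ Q ∈ LamFinset r k, (A.filter fun t => InPart t Q).card =
      ∑ t ∈ A, ((LamFinset r k).filter fun Q => InPart t Q).card := by
    intro A
    simp only [Finset.card_filter]
    exact Finset.sum_comm
  have h1 : ∑ Q ∈ LamFinset r k, (Q.filter fun U => ∃ i, 3 ≤ mult U i).card ≤
      ∑ t ∈ S, ((LamFinset r k).filter fun Q => InPart t Q).card := by
    rw [← hswap]
    exact Finset.sum_le_sum fun Q hQ => bad_card_le (hL Q hQ)
  have h2 : ∑ t : Fin 3 ↪ Pts k, ((LamFinset r k).filter fun Q => InPart t Q).card ≤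
      (LamFinset r k).card * (Mtot k * r ^ 2) := by
    rw [← hswap, ← smul_eq_mul, ← Finset.sum_const]
    exact Finset.sum_le_sum fun Q hQ => triples_card_le (hL Q hQ)
  have hD : (Mtot k).descFactorial 3 = (Finset.univ : Finset (Fin 3 ↪ Pts k)).card := by
    rw [Finset.card_univ, Fintype.card_embedding_eq, card_pts, Fintype.card_fin]
  have h3 : ∀ t : Fin 3 ↪ Pts k, ((LamFinset r k).filter fun Q => InPart t Q).card *
      (Mtot k).descFactorial 3 ≤ (LamFinset r k).card * (Mtot k * r ^ 2) := by
    intro t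
    refine le_trans ?_ h2
    rw [hD, mul_comm, ← smul_eq_mul, ← Finset.sum_const]
    exact Finset.sum_le_sum fun s _ => inPart_card_le t s
  calc _ ≤ (∑ t ∈ S, ((LamFinset r k).filter fun Q => InPart t Q).card) *
        (Mtot k).descFactorial 3 := Nat.mul_le_mul_right _ h1
    _ = ∑ t ∈ S, ((LamFinset r k).filter fun Q => InPart t Q).card *
        (Mtot k).descFactorial 3 := Finset.sum_mul _ _ _
    _ ≤ ∑ t ∈ S, (LamFinset r k).card * (Mtot k * r ^ 2) := Finset.sum_le_sum fun t _ => h3 t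
    _ = S.card * ((LamFinset r k).card * (Mtot k * r ^ 2)) := by
      rw [Finset.sum_const, smul_eq_mul]
    _ ≤ _ := Nat.mul_le_mul_right _ (sameCell_card_le k)

lemma descFactorial_three_cast (M : ℕ) (h : 3 ≤ M) : ((M.descFactorial 3 : ℕ) : ℝ) =
    (M : ℝ) * ((M : ℝ) - 1) * ((M : ℝ) - 2) := by
  obtain ⟨m, rfl⟩ := Nat.exists_eq_add_of_le h
  have e1 : 3 + m - 2 = m + 1 := by omega
  have e2 : 3 + m - 1 = m + 2 := by omega
  rw [Nat.descFactorial_succ, Nat.descFactorial_succ, Nat.descFactorial_succ,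
    Nat.descFactorial_zero, e1, e2, Nat.sub_zero]
  push_cast
  ring

lemma M3_le {n : ℕ} (k : Fin n → ℕ) : M3 k ≤ kmax k ^ 2 * Mtot k := by
  unfold M3 Mtot
  rw [Finset.mul_sum]
  apply Finset.sum_le_sum
  intro i _
  have h : k i ≤ kmax k := Finset.le_sup (f := k) (Finset.mem_univ i)
  calc k i * (k i - 1) * (k i - 2) ≤ k i * kmax k * kmax k := by
        gcongr <;> omega
    _ = _ := by ring

lemma arith_first (X m T L R : ℝ) (hX : 0 ≤ X) (hm : 3 ≤ m) (hT : 0 ≤ T) (hL : 0 ≤ L)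
    (hc : X * (m * (m - 1) * (m - 2)) ≤ T * (L * (m * R ^ 2))) :
    X / L ≤ 9 / 2 * R ^ 2 * T / m ^ 2 := by
  have hMp : 0 < m := by linarith
  rcases hL.eq_or_lt with hl | hl
  · rw [← hl, div_zero]
    positivity
  · rw [div_le_div_iff₀ hl (by positivity)]
    have hq : X * m * (2 / 9 * m ^ 2) ≤ X * m * ((m - 1) * (m - 2)) := by
      apply mul_le_mul_of_nonneg_left _ (by positivity)
      nlinarith
    have : (X * m ^ 2) * m ≤ (9 / 2 * R ^ 2 * T * L) * m := by
      linarith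
    exact le_of_mul_le_mul_right this hMp

lemma arith_second (m T K R : ℝ) (hm : 3 ≤ m) (h : T ≤ K ^ 2 * m) :
    9 / 2 * R ^ 2 * T / m ^ 2 ≤ 9 / 2 * R ^ 2 * K ^ 2 / m := by
  have hMp : 0 < m := by linarith
  rw [div_le_div_iff₀ (by positivity) hMp]
  have : 0 ≤ 9 / 2 * R ^ 2 * m := by positivity
  linarith [mul_le_mul_of_nonneg_left h this]

/-- the expected number of parts containing three or more points
from a single cell is O(M₃/M²) = O(k_max²/M). -/
theorem expected_triple_parts (r : ℕ) (hr : 3 ≤ r) :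
    ∃ C δ : ℝ, 0 < C ∧ 0 < δ ∧
      ∀ (n : ℕ) (k : Fin n → ℕ),
        r ∣ Mtot k → (kmax k : ℝ) ^ 3 ≤ δ * (Mtot k : ℝ) →
        (∑ Q ∈ LamFinset r k, ((Q.filter fun U => ∃ i, 3 ≤ mult U i).card : ℝ)) /
              ((LamFinset r k).card : ℝ) ≤ C * (M3 k : ℝ) / (Mtot k : ℝ) ^ 2 ∧
          C * (M3 k : ℝ) / (Mtot k : ℝ) ^ 2 ≤ C * (kmax k : ℝ) ^ 2 / (Mtot k : ℝ) := by
  refine ⟨9 / 2 * (r : ℝ) ^ 2, 1, by positivity, one_pos, ?_⟩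
  intro n k hdvd _
  have hcount := main_count r k
  have hM3 : (M3 k : ℝ) ≤ (kmax k : ℝ) ^ 2 * (Mtot k : ℝ) := by exact_mod_cast M3_le k
  rcases Nat.eq_zero_or_pos (Mtot k) with h0 | hpos
  · have hM30 : M3 k = 0 := by
      have := M3_le k
      rw [h0] at this
      omega
    have hz : ∀ Q ∈ LamFinset r k, ((Q.filter fun U => ∃ i, 3 ≤ mult U i).card : ℝ) = 0 := by
      intro Q hQ
      have h := part_card (Finset.mem_filter.1 hQ).2
      rw [h0] at h
      have : Q.card = 0 := by
        rcases Nat.mul_eq_zero.1 h with h | h <;> omega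
      rw [Finset.card_eq_zero.1 this]
      simp
    rw [Finset.sum_eq_zero hz]
    simp [h0]
  · have hge : 3 ≤ Mtot k := le_trans hr (Nat.le_of_dvd hpos hdvd)
    have hMr : (3 : ℝ) ≤ (Mtot k : ℝ) := by exact_mod_cast hge
    have hMp : (0 : ℝ) < (Mtot k : ℝ) := by linarith
    constructor
    · have hc : (∑ Q ∈ LamFinset r k, ((Q.filter fun U => ∃ i, 3 ≤ mult U i).card : ℝ)) *
          ((Mtot k : ℝ) * ((Mtot k : ℝ) - 1) * ((Mtot k : ℝ) - 2)) ≤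
          (M3 k : ℝ) * (((LamFinset r k).card : ℝ) * ((Mtot k : ℝ) * (r : ℝ) ^ 2)) := by
        have hd : (((Mtot k).descFactorial 3 : ℕ) : ℝ) =
            (Mtot k : ℝ) * ((Mtot k : ℝ) - 1) * ((Mtot k : ℝ) - 2) := descFactorial_three_cast _ hge
        rw [← hd]
        have hcount' := (Nat.cast_le (α := ℝ)).2 hcount
        simpa only [Nat.cast_mul, Nat.cast_sum, Nat.cast_pow] using hcount'
      exact arith_first _ _ _ _ _ (Finset.sum_nonneg fun _ _ => Nat.cast_nonneg _) hMr
        (Nat.cast_nonneg _) (Nat.cast_nonneg _) hc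
    · exact arith_second _ _ _ _ hMr hM3
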